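/- Let g ∈ ℂ[x] be a polynomial that is not LRS-degenerate, and set h(x) = g(x)·g(−x). Then for every k ≥ 2 with k ≠ 2, the polynomial h is not k-LRS-degenerate. -/

import Mathlib

open Polynomial

/-- A nonzero polynomial `f ∈ ℂ[x]` is `k`-LRS-degenerate if it has two
distinct roots `α, β` such that `α/β` is a primitive `k`-th root of unity. -/
def IsLRSDegenerateOfOrder (f : Polynomial ℂ) (k : ℕ) : Prop :=
  f ≠ 0 ∧ ∃ α β : ℂ, f.IsRoot α ∧ f.IsRoot β ∧ α ≠ β ∧ IsPrimitiveRoot (α / β) k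

/-- `f` is LRS-degenerate if it is `k`-LRS-degenerate for some `k ≥ 2`. -/
def IsLRSDegenerate (f : Polynomial ℂ) : Prop :=
  ∃ k : ℕ, 2 ≤ k ∧ IsLRSDegenerateOfOrder f k

/-- A polynomial that is not LRS-degenerate has no two distinct roots whose quotient is a root of
unity. -/
lemma eq_of_isRoot_of_div_pow_eq_one {g : ℂ[X]} (hg : ¬ IsLRSDegenerate g) (hg0 : g ≠ 0)
    {a b : ℂ} (ha : g.IsRoot a) (hb : g.IsRoot b) {n : ℕ} (hn : 0 < n) (h : (a / b) ^ n = 1) :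
    a = b := by
  by_contra hab
  have hb0 : b ≠ 0 := by
    rintro rfl
    simp [hn.ne'] at h
  have hpos : 0 < orderOf (a / b) := orderOf_pos_iff.2 (isOfFinOrder_iff_pow_eq_one.2 ⟨n, hn, h⟩)
  have hne : orderOf (a / b) ≠ 1 := fun h1 =>
    hab ((div_eq_one_iff_eq hb0).1 (orderOf_eq_one_iff.1 h1))
  exact hg ⟨orderOf (a / b), by omega, hg0, a, b, ha, hb, hab, IsPrimitiveRoot.orderOf _⟩

/-- If `g ∈ ℂ[x]` is not LRS-degenerate then `h(x) = g(x)·g(−x)` is not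
`k`-LRS-degenerate for any `k ≥ 2` with `k ≠ 2`. -/
theorem stmt11 (g : Polynomial ℂ) (hg : ¬ IsLRSDegenerate g) (k : ℕ) (hk : 2 ≤ k)
    (hk2 : k ≠ 2) :
    ¬ IsLRSDegenerateOfOrder (g * g.comp (-Polynomial.X)) k := by
  rintro ⟨h0, a, b, ha, hb, hab, hr⟩
  have hg0 : g ≠ 0 := left_ne_zero_of_mul h0
  have hb0 : b ≠ 0 := by
    rintro rfl
    exact hr.ne_zero (by omega) (div_zero a)
  have hpow : (a / b) ^ (2 * k) = 1 := by rw [mul_comm, pow_mul, hr.pow_eq_one, one_pow]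
  have hnpow : (-(a / b)) ^ (2 * k) = 1 := by rw [(even_two_mul k).neg_pow, hpow]
  have hneg : a ≠ -b := by
    rintro rfl
    rw [neg_div, div_self hb0] at hr
    have h2 : k ∣ 2 := hr.dvd_of_pow_eq_one 2 (by norm_num)
    have := Nat.le_of_dvd two_pos h2
    omega
  have h2k : 0 < 2 * k := by omega
  simp only [IsRoot.def, eval_mul, eval_comp, eval_neg, eval_X, mul_eq_zero] at ha hb
  rcases ha with ha | ha <;> rcases hb with hb | hb
  · exact hab (eq_of_isRoot_of_div_pow_eq_one hg hg0 ha hb h2k hpow)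
  · exact hneg (eq_of_isRoot_of_div_pow_eq_one hg hg0 ha hb h2k (by rwa [div_neg]))
  · exact hneg (neg_eq_iff_eq_neg.1
      (eq_of_isRoot_of_div_pow_eq_one hg hg0 ha hb h2k (by rwa [neg_div])))
  · exact hab (neg_injective
      (eq_of_isRoot_of_div_pow_eq_one hg hg0 ha hb h2k (by rwa [neg_div_neg_eq])))
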